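/- Fix n, d, s ∈ [0,1] and parameters 0 < q ≤ p ≤ 1 with q < 1. Then the second moment of the likelihood ratio satisfies the exact identity E_{A∼ℚ}[ L(A)² ] = E_{H,H' i.i.d. ∼ μ}[ ( p²/q + (1−p)²/(1−q) )^{ |E(P(H)) ∩ E(P(H'))| } ]. -/

import Mathlib

open Finset Filter
open scoped Classical symmDiff

noncomputable section

namespace NoisyHypergraph

/-- The set of unordered pairs of distinct vertices of `[n]`, encoded as 2-element subsets. -/
def pairs (n : ℕ) : Finset (Finset (Fin n)) :=
  (Finset.univ : Finset (Fin n)).powersetCard 2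

/-- The set of `d`-element subsets of `[n]` (potential hyperedges). -/
def dsets (n d : ℕ) : Finset (Finset (Fin n)) :=
  (Finset.univ : Finset (Fin n)).powersetCard d

/-- Projection of a hypergraph: all pairs of distinct vertices contained in some hyperedge. -/
def proj (n : ℕ) (H : Finset (Finset (Fin n))) : Finset (Finset (Fin n)) :=
  (pairs n).filter fun e => ∃ Ψ ∈ H, e ⊆ Ψ

/-- Mass function of `μ_{n,d,s}`: each `d`-subset included independently with probability `s`. -/
def mu (n d : ℕ) (s : ℝ) (H : Finset (Finset (Fin n))) : ℝ :=
  s ^ H.card * (1 - s) ^ ((dsets n d).card - H.card)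

/-- Conditional mass function of the noisy projection `A` given the hypergraph `H`:
edges of `P(H)` kept with probability `p`, other pairs added with probability `q`. -/
def condP (n : ℕ) (p q : ℝ) (H A : Finset (Finset (Fin n))) : ℝ :=
  p ^ (A ∩ proj n H).card * (1 - p) ^ (proj n H \ A).card *
    q ^ (A \ proj n H).card * (1 - q) ^ ((pairs n \ proj n H) \ A).card

/-- Erdős–Rényi `G(n,q)` mass function. -/
def er (n : ℕ) (q : ℝ) (A : Finset (Finset (Fin n))) : ℝ :=
  q ^ A.card * (1 - q) ^ ((pairs n).card - A.card)

/-- Joint planted mass function of `(H, A)` under `ℙ`. -/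
def joint (n d : ℕ) (s p q : ℝ) (H A : Finset (Finset (Fin n))) : ℝ :=
  mu n d s H * condP n p q H A

/-- Marginal law of `A` under the planted measure `ℙ`. -/
def marg (n d : ℕ) (s p q : ℝ) (A : Finset (Finset (Fin n))) : ℝ :=
  ∑ H ∈ (dsets n d).powerset, joint n d s p q H A

/-- Probability of an event under the joint planted law `ℙ`. -/
def prJoint (n d : ℕ) (s p q : ℝ)
    (E : Finset (Finset (Fin n)) → Finset (Finset (Fin n)) → Prop) : ℝ :=
  ∑ H ∈ (dsets n d).powerset, ∑ A ∈ (pairs n).powerset,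
    if E H A then joint n d s p q H A else 0

/-- Probability of an event under the Erdős–Rényi law. -/
def prER (n : ℕ) (q : ℝ) (E : Finset (Finset (Fin n)) → Prop) : ℝ :=
  ∑ A ∈ (pairs n).powerset, if E A then er n q A else 0

/-- The clique estimator `Ĥ(A)`: all `d`-subsets of `[n]` that form a clique in `A`. -/
def cliqueEst (n d : ℕ) (A : Finset (Finset (Fin n))) : Finset (Finset (Fin n)) :=
  (dsets n d).filter fun Ψ => ∀ e ∈ pairs n, e ⊆ Ψ → e ∈ A


/-- `condP` as a product over the pairs in `A` and outside `A`. -/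
lemma condP_eq_prod (n : ℕ) (p q : ℝ) (H A : Finset (Finset (Fin n))) (hA : A ⊆ pairs n) :
    condP n p q H A = (∏ e ∈ A, if e ∈ proj n H then p else q) *
      ∏ e ∈ pairs n \ A, if e ∈ proj n H then 1 - p else 1 - q := by
  have hP : proj n H ⊆ pairs n := Finset.filter_subset _ _
  rw [Finset.prod_ite, Finset.prod_ite]
  simp only [Finset.prod_const]
  have h1 : A.filter (fun e => e ∈ proj n H) = A ∩ proj n H := by
    ext e; simp
  have h2 : A.filter (fun e => e ∉ proj n H) = A \ proj n H := by
    ext e; simp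
  have h3 : (pairs n \ A).filter (fun e => e ∈ proj n H) = proj n H \ A := by
    ext e
    have := @hP e
    simp only [Finset.mem_filter, Finset.mem_sdiff]
    tauto
  have h4 : (pairs n \ A).filter (fun e => e ∉ proj n H) = (pairs n \ proj n H) \ A := by
    ext e
    simp only [Finset.mem_filter, Finset.mem_sdiff]
    tauto
  rw [h1, h2, h3, h4, condP]
  ring

lemma er_eq_prod (n : ℕ) (q : ℝ) (A : Finset (Finset (Fin n))) (hA : A ⊆ pairs n) :
    er n q A = (∏ _e ∈ A, q) * ∏ _e ∈ pairs n \ A, (1 - q) := by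
  simp only [Finset.prod_const, er, Finset.card_sdiff_of_subset hA]

/-- The inner sum for fixed `H, H'`. -/
lemma sum_condP (n : ℕ) (p q : ℝ) (hq0 : 0 < q) (hq1 : q < 1)
    (H H' : Finset (Finset (Fin n))) :
    ∑ A ∈ (pairs n).powerset, condP n p q H A * condP n p q H' A / er n q A
      = (p ^ 2 / q + (1 - p) ^ 2 / (1 - q)) ^ (proj n H ∩ proj n H').card := by
  have hq1' : 1 - q ≠ 0 := by linarith
  have hq0' : q ≠ 0 := hq0.ne'
  have key : ∀ A ∈ (pairs n).powerset, condP n p q H A * condP n p q H' A / er n q A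
      = (∏ e ∈ A, (if e ∈ proj n H then p else q) * (if e ∈ proj n H' then p else q) / q) *
        ∏ e ∈ pairs n \ A, (if e ∈ proj n H then 1 - p else 1 - q) *
          (if e ∈ proj n H' then 1 - p else 1 - q) / (1 - q) := by
    intro A hA
    rw [Finset.mem_powerset] at hA
    rw [condP_eq_prod n p q H A hA, condP_eq_prod n p q H' A hA, er_eq_prod n q A hA,
      Finset.prod_div_distrib, Finset.prod_div_distrib, Finset.prod_mul_distrib,
      Finset.prod_mul_distrib, div_mul_div_comm]
    ring
  rw [Finset.sum_congr rfl key, ← Finset.prod_add]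
  have hsub : proj n H ∩ proj n H' ⊆ pairs n :=
    Finset.inter_subset_left.trans (Finset.filter_subset _ _)
  rw [← Finset.prod_subset hsub, ← Finset.prod_const]
  · refine Finset.prod_congr rfl fun e he => ?_
    rw [Finset.mem_inter] at he
    simp only [he.1, he.2, if_true]
    ring
  · intro e _ he
    rw [Finset.mem_inter] at he
    by_cases h1 : e ∈ proj n H <;> by_cases h2 : e ∈ proj n H'
    · exact absurd ⟨h1, h2⟩ he
    all_goals
      simp only [h1, h2, if_true, if_false]
      field_simp
      try ring

/-- exact identity for the second moment of the likelihood ratio: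
`E_ℚ[L(A)²] = E_{H,H'~μ⊗μ}[(p²/q + (1−p)²/(1−q))^{|E(P(H)) ∩ E(P(H'))|}]`. -/
theorem likelihood_second_moment_identity
    (n d : ℕ) (hd : 2 ≤ d) (s p q : ℝ)
    (hs : 0 ≤ s ∧ s ≤ 1)
    (hq0 : 0 < q) (hqp : q ≤ p) (hp1 : p ≤ 1) (hq1 : q < 1) :
    ∑ A ∈ (pairs n).powerset,
        er n q A * (marg n d s p q A / er n q A) ^ 2
      = ∑ H ∈ (dsets n d).powerset, ∑ H' ∈ (dsets n d).powerset,
          mu n d s H * mu n d s H' *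
            (p ^ 2 / q + (1 - p) ^ 2 / (1 - q)) ^ (proj n H ∩ proj n H').card := by
  have step : ∀ A ∈ (pairs n).powerset, er n q A * (marg n d s p q A / er n q A) ^ 2
      = ∑ H ∈ (dsets n d).powerset, ∑ H' ∈ (dsets n d).powerset,
          mu n d s H * mu n d s H' * (condP n p q H A * condP n p q H' A / er n q A) := by
    intro A _
    have her : er n q A ≠ 0 :=
      mul_ne_zero (pow_ne_zero _ hq0.ne') (pow_ne_zero _ (by linarith))
    have h1 : er n q A * (marg n d s p q A / er n q A) ^ 2
        = marg n d s p q A * marg n d s p q A / er n q A := by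
      field_simp
    rw [h1]
    simp only [marg, joint]
    rw [Finset.sum_mul_sum, Finset.sum_div]
    refine Finset.sum_congr rfl fun H _ => ?_
    rw [Finset.sum_div]
    refine Finset.sum_congr rfl fun H' _ => ?_
    ring
  rw [Finset.sum_congr rfl step, Finset.sum_comm]
  refine Finset.sum_congr rfl fun H _ => ?_
  rw [Finset.sum_comm]
  refine Finset.sum_congr rfl fun H' _ => ?_
  rw [← Finset.mul_sum, sum_condP n p q hq0 hq1 H H']

end NoisyHypergraph
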